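/- arXiv:2108.12021 — 3 statements merged into one kernel-verified Lean document; each statement's English description precedes it below -/
import Mathlib

section
/- Let B be a commutative k-domain with a fundamental pair (D,U), and for d ∈ ℤ let B_d = ker([D,U] − d·id) as a k-subspace of B. Then: (a) B = ⊕_{d∈ℤ} B_d is a ℤ-grading of B, i.e., the subspaces B_d are linearly independent, their sum is B, and B_d · B_e ⊆ B_{d+e} for all d, e ∈ ℤ; (b) D and U are homogeneous for this grading with D(B_d) ⊆ B_{d+2} and U(B_d) ⊆ B_{d−2} for all d ∈ ℤ. -/
/-- A derivation is locally nilpotent if every element is annihilated by some power. -/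
def IsLND {R B : Type*} [CommRing R] [CommRing B] [Algebra R B]
    (D : Derivation R B B) : Prop :=
  ∀ b : B, ∃ n : ℕ, (D.toLinearMap ^ n) b = 0

/-- The degree-`d` piece `B_d = ker([D,U] - d·id)` of the `ℤ`-grading induced by `(D, U)`. -/
def gradePiece {R B : Type*} [CommRing R] [CommRing B] [Algebra R B]
    (D U : Derivation R B B) (d : ℤ) : Submodule R B :=
  LinearMap.ker ((⁅D, U⁆ : Derivation R B B).toLinearMap
    - d • (LinearMap.id : B →ₗ[R] B))

/-- `(D, U)` is a fundamental pair: both are locally nilpotent, `[D,[D,U]] = -2D`,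
`[U,[D,U]] = 2U`, and `B` is the sum of the eigenspaces of `[D,U]`. -/
def IsFundamentalPair {R B : Type*} [CommRing R] [CommRing B] [Algebra R B]
    (D U : Derivation R B B) : Prop :=
  IsLND D ∧ IsLND U ∧
    ⁅D, ⁅D, U⁆⁆ = (-2 : ℤ) • D ∧
    ⁅U, ⁅D, U⁆⁆ = (2 : ℤ) • U ∧
    (⨆ d : ℤ, gradePiece D U d) = ⊤

theorem mem_gradePiece {R B : Type*} [CommRing R] [CommRing B] [Algebra R B]
    {D U : Derivation R B B} {d : ℤ} {x : B} :
    x ∈ gradePiece D U d ↔ (⁅D, U⁆ : Derivation R B B) x = d • x := by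
  rw [gradePiece, LinearMap.mem_ker, LinearMap.sub_apply, sub_eq_zero]
  rfl

theorem gradePiece_eq_eigenspace {k B : Type*} [Field k] [CommRing B] [Algebra k B]
    (D U : Derivation k B B) (d : ℤ) :
    gradePiece D U d =
      Module.End.eigenspace (⁅D, U⁆ : Derivation k B B).toLinearMap (d : k) := by
  ext x
  rw [mem_gradePiece, Module.End.mem_eigenspace_iff, Int.cast_smul_eq_zsmul]
  rfl

theorem iSupIndep_gradePiece {k B : Type*} [Field k] [CharZero k] [CommRing B]
    [Algebra k B] (D U : Derivation k B B) : iSupIndep (fun d : ℤ => gradePiece D U d) := by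
  simp_rw [gradePiece_eq_eigenspace]
  exact (Module.End.eigenspaces_iSupIndep _).comp Int.cast_injective

theorem mul_mem_gradePiece {R B : Type*} [CommRing R] [CommRing B] [Algebra R B]
    {D U : Derivation R B B} {d e : ℤ} {x y : B} (hx : x ∈ gradePiece D U d)
    (hy : y ∈ gradePiece D U e) : x * y ∈ gradePiece D U (d + e) := by
  rw [mem_gradePiece] at *
  rw [Derivation.leibniz, hx, hy]
  simp only [zsmul_eq_mul, smul_eq_mul]
  push_cast
  ring

/-- If `[T, [D, U]] = -c T`, then `T` is homogeneous of degree `c`. -/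
theorem apply_mem_gradePiece {R B : Type*} [CommRing R] [CommRing B] [Algebra R B]
    {D U T : Derivation R B B} {c d : ℤ} (hT : ⁅T, ⁅D, U⁆⁆ = (-c) • T) {x : B}
    (hx : x ∈ gradePiece D U d) : T x ∈ gradePiece D U (d + c) := by
  rw [mem_gradePiece] at *
  have h := DFunLike.congr_fun hT x
  rw [Derivation.commutator_apply, hx, map_zsmul, Derivation.smul_apply] at h
  rw [add_smul, ← sub_eq_zero]
  rw [neg_smul, ← sub_eq_zero] at h
  rw [← neg_eq_zero, ← h]
  abel

/-- for a fundamental pair `(D,U)` on a commutative `k`-domain `B`, the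
eigenspaces `B_d = ker([D,U] − d·id)` form a `ℤ`-grading of `B` (internal direct sum and
`B_d·B_e ⊆ B_{d+e}`), and `D`, `U` are homogeneous of degrees `2` and `−2`. -/
theorem stmt_2 {k B : Type*} [Field k] [CharZero k] [CommRing B] [IsDomain B] [Algebra k B]
    (D U : Derivation k B B) (hDU : IsFundamentalPair D U) :
    DirectSum.IsInternal (fun d : ℤ => gradePiece D U d) ∧
    (∀ d e : ℤ, ∀ x ∈ gradePiece D U d, ∀ y ∈ gradePiece D U e,
      x * y ∈ gradePiece D U (d + e)) ∧
    (∀ d : ℤ, ∀ x ∈ gradePiece D U d, D x ∈ gradePiece D U (d + 2)) ∧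
    (∀ d : ℤ, ∀ x ∈ gradePiece D U d, U x ∈ gradePiece D U (d - 2)) := by
  obtain ⟨-, -, hD, hU, hsup⟩ := hDU
  refine ⟨DirectSum.isInternal_submodule_of_iSupIndep_of_iSup_eq_top
    (iSupIndep_gradePiece D U) hsup, fun d e x hx y hy => mul_mem_gradePiece hx hy,
    fun d x hx => apply_mem_gradePiece hD hx, fun d x hx => ?_⟩
  rw [sub_eq_add_neg]
  exact apply_mem_gradePiece (by rwa [neg_neg]) hx
end

section
/- Let B be a commutative k-domain with fundamental pair (D,U), with induced ℤ-grading B = ⊕_{d∈ℤ} B_d, and let A = ker D. If f ∈ A is a nonzero homogeneous element of degree d (i.e., f ∈ A ∩ B_d, f ≠ 0), then the U-degree of f equals d, that is, U^d f ≠ 0 and U^{d+1} f = 0. In particular d ≥ 0, so the ℤ-grading of B restricts to an ℕ-grading of A. -/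
section

variable {R B : Type*} [CommRing R] [CommRing B] [Algebra R B] {D U : Derivation R B B}

theorem mem_gradePiece_iff {d : ℤ} {f : B} : f ∈ gradePiece D U d ↔ ⁅D, U⁆ f = d • f := by
  rw [gradePiece, LinearMap.mem_ker, LinearMap.sub_apply, sub_eq_zero]
  rfl

/-- `U` lowers degrees by two. -/
theorem commutator_pow_apply (hU : ⁅U, ⁅D, U⁆⁆ = (2 : ℤ) • U) {d : ℤ} {f : B}
    (hf : ⁅D, U⁆ f = d • f) (n : ℕ) :
    ⁅D, U⁆ ((U.toLinearMap ^ n) f) = (d - 2 * n) • (U.toLinearMap ^ n) f := by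
  induction n with
  | zero => simpa using hf
  | succ n ih =>
    have h := DFunLike.congr_fun hU ((U.toLinearMap ^ n) f)
    rw [Derivation.commutator_apply, ih, map_zsmul, Derivation.smul_apply, sub_eq_iff_eq_add] at h
    have hU' : (U.toLinearMap ^ (n + 1)) f = U ((U.toLinearMap ^ n) f) := by
      rw [pow_succ']
      rfl
    rw [hU', ← sub_eq_iff_eq_add'.mpr h, ← sub_smul]
    congr 1
    push_cast
    ring

/-- The action of the raising operator `D` on the `U`-orbit of a highest weight vector. -/
theorem apply_pow_succ_apply (hU : ⁅U, ⁅D, U⁆⁆ = (2 : ℤ) • U) {d : ℤ} {f : B}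
    (hD : D f = 0) (hf : ⁅D, U⁆ f = d • f) (n : ℕ) :
    D ((U.toLinearMap ^ (n + 1)) f) = ((n + 1) * (d - n)) • (U.toLinearMap ^ n) f := by
  have step (m : ℕ) : D ((U.toLinearMap ^ (m + 1)) f) =
      (d - 2 * m) • (U.toLinearMap ^ m) f + U (D ((U.toLinearMap ^ m) f)) := by
    rw [← commutator_pow_apply hU hf, Derivation.commutator_apply, sub_add_cancel, pow_succ']
    rfl
  induction n with
  | zero => simpa [hD] using step 0
  | succ n ih =>
    have hU' : U ((U.toLinearMap ^ n) f) = (U.toLinearMap ^ (n + 1)) f := by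
      rw [pow_succ']
      rfl
    rw [step, ih, map_zsmul, hU', ← add_smul]
    congr 1
    push_cast
    ring

end

/-- if `f ∈ ker D` is nonzero and homogeneous of degree `d` for the grading
induced by a fundamental pair `(D,U)`, then `d ≥ 0` and the `U`-degree of `f` is exactly
`d`: `U^d f ≠ 0` and `U^{d+1} f = 0`. -/
theorem stmt_4 {k B : Type*} [Field k] [CharZero k] [CommRing B] [IsDomain B] [Algebra k B]
    (D U : Derivation k B B) (hDU : IsFundamentalPair D U)
    (d : ℤ) (f : B) (hf0 : f ≠ 0) (hfA : D f = 0) (hfd : f ∈ gradePiece D U d) :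
    0 ≤ d ∧ (U.toLinearMap ^ d.toNat) f ≠ 0 ∧ (U.toLinearMap ^ (d.toNat + 1)) f = 0 := by
  obtain ⟨-, hU, -, hUH, -⟩ := hDU
  have : CharZero B := charZero_of_injective_algebraMap (algebraMap k B).injective
  obtain ⟨m, hm, hm'⟩ : ∃ m : ℕ, (U.toLinearMap ^ m) f ≠ 0 ∧ (U.toLinearMap ^ (m + 1)) f = 0 := by
    by_contra! h
    obtain ⟨n, hn⟩ := hU f
    exact Nat.rec (motive := fun n => (U.toLinearMap ^ n) f ≠ 0) (by simpa using hf0) h n hn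
  have h := apply_pow_succ_apply hUH hfA (mem_gradePiece_iff.mp hfd) m
  rw [hm', map_zero, eq_comm, smul_eq_zero_iff_left hm] at h
  obtain rfl : d = m := by
    rcases mul_eq_zero.mp h with h | h <;> lia
  exact ⟨by positivity, by simpa using hm, by simpa using hm'⟩
end

section
/- Let B be an affine k-domain with a nontrivial fundamental pair (D,U), A = ker D, Ω = ker U, and A_0 = A ∩ Ω. Then B = Ω ⊕ D(B) and B = A ⊕ U(B) as A_0-modules; that is, Ω ∩ D(B) = {0} and Ω + D(B) = B, and similarly A ∩ U(B) = {0} and A + U(B) = B. -/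
namespace IsSl2Triple

open Module

attribute [local instance] LieRing.ofAssociativeRing

variable {k V : Type*} [Field k] [AddCommGroup V] [Module k V] {h e f : End k V}

lemma e_f_apply (t : IsSl2Triple h e f) (v : V) : e (f v) = f (e v) + h v := by
  rw [← t.lie_e_f, Ring.lie_def]
  simp

lemma h_e_apply (t : IsSl2Triple h e f) (v : V) : h (e v) = e (h v) + (2 : k) • e v := by
  have := LinearMap.congr_fun t.lie_h_e_nsmul v
  rw [Ring.lie_def] at this
  simp only [LinearMap.sub_apply, End.mul_apply, LinearMap.smul_apply] at this
  rw [two_smul, ← two_nsmul, ← this]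
  abel

lemma mem_eigenspace_e (t : IsSl2Triple h e f) {v : V} {d : ℤ} (hv : v ∈ h.eigenspace (d : k)) :
    e v ∈ h.eigenspace ((d + 2 : ℤ) : k) := by
  rw [End.mem_eigenspace_iff] at hv ⊢
  rw [t.h_e_apply, hv, map_smul, ← add_smul]
  push_cast
  rfl

lemma eigenspace_neg (h : End k V) (d : ℤ) :
    (-h).eigenspace ((-d : ℤ) : k) = h.eigenspace (d : k) := by
  ext v
  simp

lemma mem_eigenspace_f (t : IsSl2Triple h e f) {v : V} {d : ℤ} (hv : v ∈ h.eigenspace (d : k)) :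
    f v ∈ h.eigenspace ((d - 2 : ℤ) : k) := by
  rw [← eigenspace_neg] at hv ⊢
  convert t.symm.mem_eigenspace_e hv using 3
  ring

variable [CharZero k]

/-- On the part of positive weight where `e` is nilpotent, `f * e` has no negative integer
eigenvalue. -/
lemma eq_zero_of_f_e_eq (t : IsSl2Triple h e f) {n : ℕ} {c d : ℤ} {v : V} (hc : 0 < c)
    (hd : 0 < d) (hv : v ∈ h.eigenspace (d : k)) (hn : (e ^ n) v = 0)
    (hfe : f (e v) = -(c : k) • v) : v = 0 := by
  induction n generalizing c d v with
  | zero => simpa using hn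
  | succ n ih =>
    have hev := t.mem_eigenspace_e hv
    have h0 : e v = 0 := by
      refine ih (c := c + d + 2) (d := d + 2) (by lia) (by lia) hev (by simpa [pow_succ] using hn) ?_
      have h1 := t.e_f_apply (e v)
      rw [hfe, End.mem_eigenspace_iff.1 hev, map_smul] at h1
      rw [eq_sub_of_add_eq h1.symm, ← sub_smul]
      congr 1
      push_cast
      ring
    rw [h0, map_zero] at hfe
    have hc' : (c : k) ≠ 0 := by exact_mod_cast hc.ne'
    simpa [hc'] using hfe.symm

/-- On the part of positive weight where `e` is nilpotent, `f * e + c` is surjective for every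
positive integer `c`. -/
lemma exists_f_e_add_eq (t : IsSl2Triple h e f) {n : ℕ} {c d : ℤ} {v : V} (hc : 0 < c)
    (hd : 0 < d) (hv : v ∈ h.eigenspace (d : k)) (hn : (e ^ n) v = 0) :
    ∃ w ∈ h.eigenspace (d : k), f (e w) + (c : k) • w = v := by
  induction n generalizing c d v with
  | zero => exact ⟨0, zero_mem _, by simpa using hn.symm⟩
  | succ n ih =>
    obtain ⟨w, hw, hwv⟩ := ih (c := c + d + 2) (d := d + 2) (by lia) (by lia)
      (t.mem_eigenspace_e hv) (by simpa [pow_succ] using hn)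
    have hc' : (c : k) ≠ 0 := by exact_mod_cast hc.ne'
    have hfw : f w ∈ h.eigenspace (d : k) := by simpa using t.mem_eigenspace_f hw
    refine ⟨(c : k)⁻¹ • (v - f w), Submodule.smul_mem _ _ (sub_mem hv hfw), ?_⟩
    have key : f (e (f w)) + (c : k) • f w = f (e v) := by
      rw [← hwv, t.e_f_apply, End.mem_eigenspace_iff.1 hw, add_assoc]
      simp only [map_add, map_smul, add_assoc, ← add_smul]
      congr 2
      push_cast
      ring
    simp only [map_smul, map_sub, smul_inv_smul₀ hc', ← key]
    rw [add_sub_cancel_left, inv_smul_smul₀ hc', add_sub_cancel]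

lemma exists_e_f_eq_of_pos (t : IsSl2Triple h e f) (he : ∀ v, ∃ n : ℕ, (e ^ n) v = 0) {d : ℤ}
    (hd : 0 < d) {v : V} (hv : v ∈ h.eigenspace (d : k)) : ∃ w, e (f w) = v := by
  obtain ⟨n, hn⟩ := he v
  obtain ⟨w, hw, hwv⟩ := t.exists_f_e_add_eq hd hd hv hn
  exact ⟨w, by rw [t.e_f_apply, End.mem_eigenspace_iff.1 hw, hwv]⟩

lemma e_eq_zero_of_f_e_eq_zero (t : IsSl2Triple h e f) (he : ∀ v, ∃ n : ℕ, (e ^ n) v = 0)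
    (hf : ∀ v, ∃ n : ℕ, (f ^ n) v = 0) {d : ℤ} {v : V} (hv : v ∈ h.eigenspace (d : k))
    (hfe : f (e v) = 0) : e v = 0 := by
  rcases lt_or_ge d 0 with hd | hd
  · obtain ⟨n, hn⟩ := hf v
    have : v = 0 := by
      refine t.symm.eq_zero_of_f_e_eq (c := -d) (d := -d) (by lia) (by lia)
        (by rwa [eigenspace_neg]) hn ?_
      rw [t.e_f_apply, hfe, End.mem_eigenspace_iff.1 hv]
      simp
    rw [this, map_zero]
  · obtain ⟨n, hn⟩ := he (e v)
    have hev := t.mem_eigenspace_e hv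
    refine t.eq_zero_of_f_e_eq (c := d + 2) (by lia) (by lia) hev hn ?_
    have h1 := t.e_f_apply (e v)
    rw [hfe, map_zero, End.mem_eigenspace_iff.1 hev] at h1
    rw [neg_smul]
    exact eq_neg_of_add_eq_zero_left h1.symm

/-- If `e` and `f` are locally nilpotent and `h` is diagonalizable with integer eigenvalues, then
`ker f` is a complement of the range of `e`. -/
theorem isCompl_ker_f_range_e (t : IsSl2Triple h e f) (he : ∀ v, ∃ n : ℕ, (e ^ n) v = 0)
    (hf : ∀ v, ∃ n : ℕ, (f ^ n) v = 0) (hh : ⨆ d : ℤ, h.eigenspace (d : k) = ⊤) :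
    IsCompl (LinearMap.ker f) (LinearMap.range e) := by
  constructor
  · rw [Submodule.disjoint_def]
    rintro _ hfe ⟨v, rfl⟩
    obtain ⟨u, hu, rfl⟩ := (Submodule.mem_iSup_iff_exists_finsupp _ v).1 (hh ▸ Submodule.mem_top)
    have hind : iSupIndep fun d : ℤ ↦ h.eigenspace (d : k) :=
      h.eigenspaces_iSupIndep.comp Int.cast_injective
    rw [LinearMap.mem_ker, Finsupp.sum, map_sum, map_sum] at hfe
    have h0 := (iSupIndep_iff_finsetSum_eq_zero_imp_eq_zero _).1 hind u.support
      (fun d ↦ f (e (u d)))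
      (fun d _ ↦ by simpa using t.mem_eigenspace_f (t.mem_eigenspace_e (hu d))) hfe
    rw [Finsupp.sum, map_sum]
    exact Finset.sum_eq_zero fun d hd ↦ t.e_eq_zero_of_f_e_eq_zero he hf (hu d) (h0 d hd)
  · rw [codisjoint_iff_le_sup, ← hh, iSup_le_iff]
    intro d v hv
    rcases lt_or_ge 0 d with hd | hd
    · obtain ⟨w, rfl⟩ := t.exists_e_f_eq_of_pos he hd hv
      exact Submodule.mem_sup_right ⟨f w, rfl⟩
    · obtain ⟨w, hw⟩ := t.symm.exists_e_f_eq_of_pos hf (d := -(d - 2)) (by lia) (v := f v)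
        (by rw [eigenspace_neg]; exact t.mem_eigenspace_f hv)
      refine Submodule.mem_sup.2 ⟨v - e w, ?_, e w, ⟨w, rfl⟩, sub_add_cancel _ _⟩
      rw [LinearMap.mem_ker, map_sub, hw, sub_self]

end IsSl2Triple

section

attribute [local instance] LieRing.ofAssociativeRing

lemma IsFundamentalPair.isSl2Triple {R B : Type*} [CommRing R] [CommRing B] [IsDomain B]
    [CharZero B] [Algebra R B] {D U : Derivation R B B} (hDU : IsFundamentalPair D U)
    (hnt : ¬(D = 0 ∧ U = 0)) :
    IsSl2Triple (L := Module.End R B) (⁅D, U⁆ : Derivation R B B).toLinearMap D.toLinearMap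
      U.toLinearMap := by
  obtain ⟨_, _, hDH, hUH, _⟩ := hDU
  have smul_lin (n : ℤ) (X : Derivation R B B) : (n • X).toLinearMap = n • X.toLinearMap := rfl
  refine ⟨fun h0 ↦ hnt ?_, rfl, ?_, ?_⟩
  · have h1 : ⁅D, U⁆ = 0 := Derivation.ext fun b ↦ LinearMap.congr_fun h0 b
    rw [h1, lie_zero] at hDH hUH
    constructor <;> ext b
    · simpa using DFunLike.congr_fun hDH b
    · simpa using DFunLike.congr_fun hUH b
  · rw [← lie_skew]
    refine (congrArg (fun X ↦ -Derivation.toLinearMap X) hDH).trans ?_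
    rw [smul_lin, neg_smul, neg_neg]
    exact ofNat_zsmul _ 2
  · rw [← lie_skew]
    refine (congrArg (fun X ↦ -Derivation.toLinearMap X) hUH).trans ?_
    rw [smul_lin]
    exact congrArg Neg.neg (ofNat_zsmul _ 2)

end

/-- for a nontrivial fundamental pair `(D,U)` on an affine `k`-domain `B`,
`B = Ω ⊕ D(B)` and `B = A ⊕ U(B)`, where `A = ker D` and `Ω = ker U`. -/
theorem stmt_7 {k B : Type*} [Field k] [CharZero k] [CommRing B] [IsDomain B] [Algebra k B]
    [Algebra.FiniteType k B]
    (D U : Derivation k B B) (hDU : IsFundamentalPair D U) (hnt : ¬(D = 0 ∧ U = 0)) :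
    LinearMap.ker U.toLinearMap ⊓ LinearMap.range D.toLinearMap = ⊥ ∧
    LinearMap.ker U.toLinearMap ⊔ LinearMap.range D.toLinearMap = ⊤ ∧
    LinearMap.ker D.toLinearMap ⊓ LinearMap.range U.toLinearMap = ⊥ ∧
    LinearMap.ker D.toLinearMap ⊔ LinearMap.range U.toLinearMap = ⊤ := by
  have ⟨hD, hU, _, _, htop⟩ := hDU
  have : CharZero B := charZero_of_injective_algebraMap (algebraMap k B).injective
  let : LieRing (Module.End k B) := LieRing.ofAssociativeRing
  have t := hDU.isSl2Triple hnt
  have hh : ⨆ d : ℤ, Module.End.eigenspace (⁅D, U⁆ : Derivation k B B).toLinearMap (d : k) = ⊤ := by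
    rw [← htop]
    congr! 2 with d
    ext b
    simp [gradePiece, sub_eq_zero, Int.cast_smul_eq_zsmul]
  have hh' : ⨆ d : ℤ, Module.End.eigenspace (-(⁅D, U⁆ : Derivation k B B).toLinearMap) (d : k)
      = ⊤ := by
    rw [← hh, ← (Equiv.neg ℤ).iSup_comp]
    exact iSup_congr fun d ↦ IsSl2Triple.eigenspace_neg _ d
  have h1 := t.isCompl_ker_f_range_e hD hU hh
  have h2 := t.symm.isCompl_ker_f_range_e hU hD hh'
  exact ⟨h1.inf_eq_bot, h1.sup_eq_top, h2.inf_eq_bot, h2.sup_eq_top⟩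
end
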